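/- Let A be an (n+1)×n integer matrix and b ∈ ℤ^{n+1} such that P(A,b) = {x ∈ ℝ^n : Ax ≤ b} is an n-dimensional simplex (a bounded polytope with nonempty interior and exactly n+1 vertices). If the width w(P(A,b)) is at least Δ(A) − 1, then P(A,b) contains an integer point, i.e. P(A,b) ∩ ℤ^n ≠ ∅. -/

import Mathlib

open Matrix

/-- The polyhedron `P(A,b) = {x ∈ ℝ^n : A x ≤ b}` of an integer matrix `A` and
integer right-hand side `b`. -/
def poly {m n : ℕ} (A : Matrix (Fin m) (Fin n) ℤ) (b : Fin m → ℤ) : Set (Fin n → ℝ) :=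
  {x | ∀ i, ((A.map (Int.cast : ℤ → ℝ)).mulVec x) i ≤ (b i : ℝ)}

/-- The lattice width of a set `P ⊆ ℝ^n`: the minimum (infimum) over nonzero integer
vectors `c` of `sup_{x ∈ P} c⋅x − inf_{x ∈ P} c⋅x`. -/
noncomputable def width {n : ℕ} (P : Set (Fin n → ℝ)) : ℝ :=
  sInf {w : ℝ | ∃ c : Fin n → ℤ, c ≠ 0 ∧
    w = sSup ((fun x : Fin n → ℝ => ∑ i, (c i : ℝ) * x i) '' P)
        - sInf ((fun x : Fin n → ℝ => ∑ i, (c i : ℝ) * x i) '' P)}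

/-- `Δ(A)`: the maximum absolute value of the determinant of an `n × n` submatrix of `A`
(an `n × n` submatrix is obtained by selecting `n` pairwise distinct rows). -/
def maxDet {m n : ℕ} (A : Matrix (Fin m) (Fin n) ℤ) : ℕ :=
  (Finset.univ.filter fun f : Fin n → Fin m => Function.Injective f).sup
    fun f => ((A.submatrix f id).det).natAbs

/-- The set of nonzero absolute values of determinants of `n × n` submatrices of `A`. -/
def detVals {m n : ℕ} (A : Matrix (Fin m) (Fin n) ℤ) : Finset ℕ :=
  ((Finset.univ.filter fun f : Fin n → Fin m => Function.Injective f).image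
    fun f => ((A.submatrix f id).det).natAbs).erase 0

/-- `Δ_lcm(A)`: least common multiple of the nonzero absolute values of the determinants
of `n × n` submatrices of `A`. -/
def lcmDet {m n : ℕ} (A : Matrix (Fin m) (Fin n) ℤ) : ℕ := (detVals A).lcm id

/-- `Δ_gcd(A)`: greatest common divisor of the nonzero absolute values of the determinants
of `n × n` submatrices of `A`. -/
def gcdDet {m n : ℕ} (A : Matrix (Fin m) (Fin n) ℤ) : ℕ := (detVals A).gcd id

/-- `δ(A)`: the minimum absolute value of the determinant of an `n × n` submatrix of `A`. -/
noncomputable def minDet {m n : ℕ} (A : Matrix (Fin m) (Fin n) ℤ) : ℕ :=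
  sInf {d : ℕ | ∃ f : Fin n → Fin m, Function.Injective f ∧ ((A.submatrix f id).det).natAbs = d}

/-- In a finite abelian group generated by a family `g`, every element is a sum of fewer than
`|G|` members of the family. -/
theorem exists_list_sum_eq_length_lt_card {G ι : Type*} [AddCommGroup G] [Finite G] (g : ι → G)
    (hg : AddSubgroup.closure (Set.range g) = ⊤) (x : G) :
    ∃ l : List ι, (l.map g).sum = x ∧ l.length < Nat.card G := by
  classical
  have hex : ∃ m : ℕ, ∃ l : List ι, (l.map g).sum = x ∧ l.length = m := by
    have hx : x ∈ AddSubmonoid.closure (Set.range g) := by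
      rw [← AddSubgroup.closure_toAddSubmonoid_of_finite, hg]
      trivial
    induction hx using AddSubmonoid.closure_induction with
    | mem y hy =>
      obtain ⟨i, rfl⟩ := hy
      exact ⟨_, [i], by simp, rfl⟩
    | zero => exact ⟨_, [], by simp, rfl⟩
    | add y z _ _ hy hz =>
      obtain ⟨_, l, rfl, -⟩ := hy
      obtain ⟨_, l', rfl, -⟩ := hz
      exact ⟨_, l ++ l', by simp, rfl⟩
  obtain ⟨l, hl, hlen⟩ := Nat.find_spec hex
  refine ⟨l, hl, ?_⟩
  by_contra! hcard
  have hninj : ¬ Function.Injective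
      (fun k : Fin (l.length + 1) => ((l.take k).map g).sum) := fun h => by
    have := Nat.card_le_card_of_injective _ h
    rw [Nat.card_fin] at this
    lia
  have hpair : ∃ i j : ℕ, i < j ∧ j ≤ l.length ∧
      ((l.take i).map g).sum = ((l.take j).map g).sum := by
    simp only [Function.Injective, not_forall] at hninj
    obtain ⟨i, j, hij, hne⟩ := hninj
    rcases lt_or_gt_of_ne hne with h | h
    · exact ⟨i, j, h, by lia, hij⟩
    · exact ⟨j, i, h, by lia, hij.symm⟩
  obtain ⟨i, j, hij, hj, hs⟩ := hpair
  refine Nat.find_min hex (m := (l.take i ++ l.drop j).length) ?_ ⟨_, ?_, rfl⟩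
  · rw [← hlen]
    simp only [List.length_append, List.length_take, List.length_drop]
    lia
  · rw [List.map_append, List.sum_append, hs, ← List.sum_append, ← List.map_append,
      List.take_append_drop, hl]

/-- The lattice `B ℤⁿ` has index `|det B|` in `ℤⁿ`. -/
theorem natCard_quotient_range_mulVecLin {n : Type*} [Fintype n] [DecidableEq n]
    (B : Matrix n n ℤ) (hB : B.det ≠ 0) :
    Nat.card ((n → ℤ) ⧸ LinearMap.range B.mulVecLin) = B.det.natAbs := by
  have hinj : Function.Injective B.mulVecLin := by
    rw [← LinearMap.ker_eq_bot, LinearMap.ker_eq_bot']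
    intro v hv
    exact Matrix.eq_zero_of_mulVec_eq_zero hB hv
  rw [← Submodule.natAbs_det_equiv _ (LinearEquiv.ofInjective B.mulVecLin hinj),
    ← LinearMap.det_toLin']
  rfl

/-- Every coset of the lattice `B ℤⁿ` contains a nonnegative vector whose coordinate sum is
less than `|det B|`. -/
theorem exists_nonneg_sum_lt_natAbs_det {n : Type*} [Fintype n] [DecidableEq n]
    (B : Matrix n n ℤ) (hB : B.det ≠ 0) (b : n → ℤ) :
    ∃ z y : n → ℤ, (∀ i, 0 ≤ y i) ∧ ∑ i, y i < |B.det| ∧ B *ᵥ z + y = b := by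
  have hcard := natCard_quotient_range_mulVecLin B hB
  let q := (LinearMap.range B.mulVecLin).mkQ
  have : Finite ((n → ℤ) ⧸ LinearMap.range B.mulVecLin) :=
    Nat.finite_of_card_ne_zero (by simpa [hcard] using hB)
  have hgen : AddSubgroup.closure (Set.range fun i : n => q (Pi.single i 1)) = ⊤ := by
    rw [eq_top_iff]
    rintro x -
    obtain ⟨v, rfl⟩ := Submodule.mkQ_surjective _ x
    rw [pi_eq_sum_univ v, map_sum]
    refine sum_mem fun i _ => ?_
    rw [map_smul]
    have hi : (fun j => if i = j then (1 : ℤ) else 0) = Pi.single i 1 := by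
      ext j
      simp [Pi.single_apply, eq_comm]
    rw [hi]
    exact zsmul_mem (AddSubgroup.subset_closure (Set.mem_range_self i)) _
  obtain ⟨l, hl, hlen⟩ := exists_list_sum_eq_length_lt_card _ hgen (q b)
  rw [hcard] at hlen
  set y : n → ℤ := (l.map fun i => Pi.single i (1 : ℤ)).sum with hy
  have hqy : q y = q b := by
    rw [← hl, hy, map_list_sum, List.map_map]
    rfl
  have hmem : b - y ∈ LinearMap.range B.mulVecLin := by
    rw [← Submodule.ker_mkQ (LinearMap.range B.mulVecLin), LinearMap.mem_ker, map_sub, sub_eq_zero]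
    exact hqy.symm
  obtain ⟨z, hz⟩ := hmem
  refine ⟨z, y, ?_, ?_, ?_⟩
  · have h0 : 0 ≤ y := List.sum_nonneg fun v hv => by
      obtain ⟨i, -, rfl⟩ := List.mem_map.mp hv
      exact Pi.single_nonneg.mpr zero_le_one
    exact h0
  · have hsum : ∑ i, y i = l.length := by
      clear_value y
      subst hy
      clear * -
      induction l with
      | nil => simp
      | cons a l ih =>
        simp only [List.map_cons, List.sum_cons, Pi.add_apply, Finset.sum_add_distrib, ih]
        simp [add_comm]
    rw [hsum, Int.abs_eq_natAbs]
    exact_mod_cast hlen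
  · rw [show B *ᵥ z = b - y from hz, sub_add_cancel]

/-- The maximal minors of an `(n+1) × n` matrix, taken with alternating signs, are the
coefficients of a linear relation between its rows. -/
theorem sum_signed_minor_mul_eq_zero {R : Type*} [CommRing R] {n : ℕ}
    (A : Matrix (Fin (n + 1)) (Fin n) R) (k : Fin n) :
    ∑ i : Fin (n + 1), (-1) ^ (i : ℕ) * (A.submatrix i.succAbove id).det * A i k = 0 := by
  have h := Matrix.det_succ_column_zero
    (Matrix.of fun i => (Fin.cons (A i k) (A i) : Fin (n + 1) → R))
  rw [Matrix.det_zero_of_column_eq (Fin.succ_ne_zero k).symm (by simp)] at h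
  rw [h]
  refine Finset.sum_congr rfl fun i _ => ?_
  rw [mul_right_comm]
  rfl

/-- An integer `(n+1) × n` matrix with trivial kernel has a nonzero maximal minor. -/
theorem exists_minor_ne_zero {n : ℕ} (A : Matrix (Fin (n + 1)) (Fin n) ℤ)
    (hA : ∀ u, A *ᵥ u = 0 → u = 0) :
    ∃ i : Fin (n + 1), (A.submatrix i.succAbove id).det ≠ 0 := by
  by_contra! h
  have hrel : ∀ k : Fin (n + 1), ∃ t : ℤ, t ≠ 0 ∧ ∃ u, A *ᵥ u = Pi.single k t := by
    intro k
    have hdet : (Matrix.of fun i =>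
        (Fin.cons ((Pi.single k 1 : Fin (n + 1) → ℤ) i) (A i) : Fin (n + 1) → ℤ)).det = 0 := by
      rw [Matrix.det_succ_column_zero]
      refine Finset.sum_eq_zero fun i _ => ?_
      exact mul_eq_zero_of_right _ (h i)
    obtain ⟨v, hv, hv0⟩ := Matrix.exists_mulVec_eq_zero_iff.mpr hdet
    have hrow : A *ᵥ Fin.tail v = Pi.single k (-v 0) := by
      ext i
      have := congrFun hv0 i
      simp only [Matrix.mulVec, dotProduct, Fin.sum_univ_succ, Matrix.of_apply, Fin.cons_zero,
        Fin.cons_succ, Pi.zero_apply] at this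
      simp only [Matrix.mulVec, dotProduct, Fin.tail]
      rcases eq_or_ne i k with rfl | hik
      · simp at this ⊢
        lia
      · simpa [hik] using this
    refine ⟨-v 0, fun h0 => hv ?_, _, hrow⟩
    rw [h0, Pi.single_zero] at hrow
    have ht := hA _ hrow
    ext j
    refine Fin.cases (by simpa using h0) (fun j => congrFun ht j) j
  choose t ht u hu using hrel
  let U : Matrix (Fin n) (Fin (n + 1)) ℤ := Matrix.of fun i k => u k i
  have hAU : A * U = Matrix.diagonal t := by
    ext i k
    have := congrFun (hu k) i
    rw [Pi.single_apply] at this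
    rw [Matrix.diagonal_apply, Matrix.mul_apply]
    simp only [Matrix.mulVec, dotProduct] at this
    rw [show ∑ j, A i j * U j k = _ from this]
    split_ifs with h <;> simp [h]
  have hinj : Function.Injective U.mulVecLin := by
    rw [← LinearMap.ker_eq_bot, LinearMap.ker_eq_bot']
    intro v hv
    have h0 : (A * U) *ᵥ v = 0 := by
      rw [← Matrix.mulVec_mulVec, show U *ᵥ v = 0 from hv, Matrix.mulVec_zero]
    rw [hAU] at h0
    ext k
    have := congrFun h0 k
    rw [Matrix.mulVec_diagonal] at this
    exact (mul_eq_zero.mp this).resolve_left (ht k)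
  have := card_le_of_injective ℤ U.mulVecLin hinj
  simp at this

/-- If no nonzero integer vector `u` satisfies `A u ≤ 0`, then all maximal minors of the
`(n+1) × n` matrix `A` are nonzero and their absolute values are the coefficients of a linear
relation between the rows of `A`. -/
theorem minors_ne_zero_and_sum_abs_minor_mul_eq_zero {n : ℕ}
    (A : Matrix (Fin (n + 1)) (Fin n) ℤ)
    (hA : ∀ u, (∀ i, (A *ᵥ u) i ≤ 0) → u = 0) :
    (∀ i : Fin (n + 1), (A.submatrix i.succAbove id).det ≠ 0) ∧
      (fun i : Fin (n + 1) => |(A.submatrix i.succAbove id).det|) ᵥ* A = 0 := by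
  obtain ⟨i, hi⟩ := exists_minor_ne_zero A fun u hu => hA u fun i => by simp [hu]
  set e : Fin (n + 1) → ℤ := fun j => (-1) ^ (j : ℕ) * (A.submatrix j.succAbove id).det with he
  have habs : ∀ j, |(A.submatrix j.succAbove id).det| = |e j| := fun j => by
    simp [he, abs_mul, abs_pow]
  have heA : e ᵥ* A = 0 := funext (sum_signed_minor_mul_eq_zero A)
  have hrel : ∀ u, ∑ j, e j * (A *ᵥ u) j = 0 := fun u => by
    have := dotProduct_mulVec e A u
    rwa [heA, zero_dotProduct] at this
  have hei : e i ≠ 0 := by simpa [he] using hi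
  set B := A.submatrix i.succAbove id with hBdef
  have hpos : ∀ j, 0 < e i * e j := by
    intro j
    rcases eq_or_ne j i with rfl | hj
    · exact mul_self_pos.mpr hei
    obtain ⟨k, rfl⟩ := Fin.exists_succAbove_eq hj
    set u := -B.det • (B.adjugate *ᵥ Pi.single k 1) with hu
    have hBu : B *ᵥ u = Pi.single k (-(B.det * B.det)) := by
      rw [hu, Matrix.mulVec_smul, Matrix.mulVec_mulVec, Matrix.mul_adjugate, Matrix.smul_mulVec,
        Matrix.one_mulVec]
      ext l
      simp [Pi.single_apply]
    have hrow : ∀ l, (A *ᵥ u) (i.succAbove l) = (B *ᵥ u) l := fun l => rfl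
    have hsq : 0 < B.det * B.det := mul_self_pos.mpr hi
    have hAi : 0 < (A *ᵥ u) i := by
      by_contra! hle
      have hu0 : u = 0 := hA u fun j => by
        rcases eq_or_ne j i with rfl | hj
        · exact hle
        obtain ⟨l, rfl⟩ := Fin.exists_succAbove_eq hj
        rw [hrow, hBu, Pi.single_apply]
        split_ifs <;> lia
      have := congrFun hBu k
      rw [hu0] at this
      simp at this
      exact hi this
    have h := hrel u
    rw [Fin.sum_univ_succAbove _ i] at h
    simp only [hrow, hBu] at h
    rw [Finset.sum_eq_single k (fun l _ hl => by simp [hl]) (by simp), Pi.single_eq_same] at h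
    have h2 : (e i * e (i.succAbove k)) * (B.det * B.det) = e i * e i * (A *ᵥ u) i := by
      linear_combination -(e i) * h
    have h3 : 0 < e i * e i * (A *ᵥ u) i := mul_pos (mul_self_pos.mpr hei) hAi
    rw [← h2] at h3
    exact pos_of_mul_pos_left h3 hsq.le
  refine ⟨fun j h0 => ?_, ?_⟩
  · have := hpos j
    simp [he, h0] at this
  · have h : |e i| • (fun j : Fin (n + 1) => |(A.submatrix j.succAbove id).det|) = e i • e := by
      ext j
      simp only [Pi.smul_apply, smul_eq_mul, habs, ← abs_mul, abs_of_pos (hpos j)]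
    have h2 := smul_vecMul (|e i|) (fun j : Fin (n + 1) => |(A.submatrix j.succAbove id).det|) A
    rw [h, smul_vecMul, heA, smul_zero] at h2
    exact (smul_eq_zero.mp h2.symm).resolve_left (abs_ne_zero.mpr hei)

/-- The recession cone of a nonempty bounded polyhedron contains no nonzero integer vector. -/
theorem eq_zero_of_mulVec_nonpos {m n : ℕ} {A : Matrix (Fin m) (Fin n) ℤ} {b : Fin m → ℤ}
    (hbdd : Bornology.IsBounded (poly A b)) (hne : (poly A b).Nonempty) {u : Fin n → ℤ}
    (hu : ∀ i, (A *ᵥ u) i ≤ 0) : u = 0 := by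
  obtain ⟨x, hx⟩ := hne
  obtain ⟨C, hC⟩ := hbdd.exists_norm_le
  have hmem : ∀ k : ℕ, x + (k : ℝ) • (fun i => (u i : ℝ)) ∈ poly A b := by
    intro k i
    have hcast : (A.map (Int.cast : ℤ → ℝ) *ᵥ fun i => (u i : ℝ)) i = ((A *ᵥ u) i : ℤ) := by
      simp [Matrix.mulVec, dotProduct]
    have hnonpos : (((A *ᵥ u) i : ℤ) : ℝ) ≤ 0 := by exact_mod_cast hu i
    rw [Matrix.mulVec_add, Matrix.mulVec_smul, Pi.add_apply, Pi.smul_apply, hcast, smul_eq_mul]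
    have := hx i
    have := mul_nonpos_of_nonneg_of_nonpos (Nat.cast_nonneg (α := ℝ) k) hnonpos
    linarith
  by_contra hne
  obtain ⟨i, hi⟩ := Function.ne_iff.mp hne
  obtain ⟨k, hk⟩ := exists_nat_gt (C + |x i|)
  have h1 : |x i + k * u i| ≤ C := (norm_le_pi_norm _ i).trans (hC _ (hmem k))
  have h2 : (1 : ℝ) ≤ |(u i : ℝ)| := by exact_mod_cast Int.one_le_abs hi
  have h3 : (k : ℝ) * |(u i : ℝ)| = |(x i + k * u i) - x i| := by
    rw [add_sub_cancel_left, abs_mul, Nat.abs_cast]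
  have h4 := abs_sub (x i + k * u i) (x i)
  have h5 := le_mul_of_one_le_right (Nat.cast_nonneg (α := ℝ) k) h2
  linarith

/-- The lattice width is at most the length of any interval containing the values on `P` of a
nonzero integer functional. -/
theorem width_le {n : ℕ} {P : Set (Fin n → ℝ)} (hbdd : Bornology.IsBounded P) (hne : P.Nonempty)
    {c : Fin n → ℤ} (hc : c ≠ 0) {lo hi : ℝ} (hlo : ∀ x ∈ P, lo ≤ ∑ i, (c i : ℝ) * x i)
    (hhi : ∀ x ∈ P, ∑ i, (c i : ℝ) * x i ≤ hi) : width P ≤ hi - lo := by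
  have hbelow : BddBelow {w : ℝ | ∃ c : Fin n → ℤ, c ≠ 0 ∧
      w = sSup ((fun x : Fin n → ℝ => ∑ i, (c i : ℝ) * x i) '' P)
        - sInf ((fun x : Fin n → ℝ => ∑ i, (c i : ℝ) * x i) '' P)} := by
    refine ⟨0, ?_⟩
    rintro _ ⟨c, -, rfl⟩
    have hcont : Continuous fun x : Fin n → ℝ => ∑ i, (c i : ℝ) * x i := by fun_prop
    have himg : Bornology.IsBounded ((fun x : Fin n → ℝ => ∑ i, (c i : ℝ) * x i) '' P) :=
      (hbdd.isCompact_closure.image hcont).isBounded.subset (Set.image_mono subset_closure)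
    exact sub_nonneg.mpr (Real.sInf_le_sSup _ himg.bddBelow himg.bddAbove)
  refine (csInf_le hbelow ⟨c, hc, rfl⟩).trans (sub_le_sub ?_ ?_)
  · exact csSup_le (hne.image _) (Set.forall_mem_image.mpr hhi)
  · exact le_csInf (hne.image _) (Set.forall_mem_image.mpr hlo)

theorem natAbs_det_succAbove_le_maxDet {n : ℕ} (A : Matrix (Fin (n + 1)) (Fin n) ℤ)
    (i : Fin (n + 1)) : (A.submatrix i.succAbove id).det.natAbs ≤ maxDet A :=
  Finset.le_sup (f := fun f : Fin n → Fin (n + 1) => (A.submatrix f id).det.natAbs)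
    (by simpa using Fin.succAbove_right_injective)

/-- Let `A` be an `(n+1) × n` integer matrix and `b ∈ ℤ^{n+1}` such that
`P(A,b)` is an `n`-dimensional simplex (a bounded polytope with nonempty interior and exactly
`n+1` vertices). If `w(P(A,b)) ≥ Δ(A) − 1`, then `P(A,b)` contains an integer point. -/
theorem simplex_flatness_maxDet {n : ℕ} (A : Matrix (Fin (n + 1)) (Fin n) ℤ)
    (b : Fin (n + 1) → ℤ)
    (hbdd : Bornology.IsBounded (poly A b))
    (hfull : (interior (poly A b)).Nonempty)
    (hvert : (Set.extremePoints ℝ (poly A b)).ncard = n + 1)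
    (hwidth : width (poly A b) ≥ (maxDet A : ℝ) - 1) :
    ∃ z : Fin n → ℤ, (fun i => (z i : ℝ)) ∈ poly A b := by
  obtain ⟨x₀, hx₀⟩ := hfull.mono interior_subset
  rcases n.eq_zero_or_pos with rfl | hn
  · exact ⟨0, by convert hx₀⟩
  obtain ⟨hminor, hvec⟩ := minors_ne_zero_and_sum_abs_minor_mul_eq_zero A
    fun u hu => eq_zero_of_mulVec_nonpos hbdd ⟨x₀, hx₀⟩ hu
  set c : Fin (n + 1) → ℤ := fun i => |(A.submatrix i.succAbove id).det| with hc
  obtain ⟨i, hmax⟩ := Finite.exists_max c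
  have hci : 0 < c i := abs_pos.mpr (hminor i)
  have hcR : ∀ j, (0 : ℝ) ≤ c j := fun j => by exact_mod_cast abs_nonneg _
  have hAi : A i ≠ 0 := by
    intro h0
    have : Nontrivial (Fin (n + 1)) := Fin.nontrivial_iff_two_le.mpr (by lia)
    obtain ⟨j, hj⟩ := exists_ne i
    obtain ⟨k, hk⟩ := Fin.exists_succAbove_eq hj.symm
    exact hminor j (Matrix.det_eq_zero_of_row_eq_zero k fun l => by simp [hk, h0])
  have hrelR : ∀ x : Fin n → ℝ,
      ∑ j, (c j : ℝ) * (A.map (Int.cast : ℤ → ℝ) *ᵥ x) j = 0 := by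
    intro x
    have h0 : (fun j => (c j : ℝ)) ᵥ* A.map (Int.cast : ℤ → ℝ) = 0 := by
      ext k
      have := congrFun hvec k
      simp only [Matrix.vecMul, dotProduct, Pi.zero_apply, Matrix.map_apply] at this ⊢
      exact_mod_cast this
    have := dotProduct_mulVec (fun j => (c j : ℝ)) (A.map (Int.cast : ℤ → ℝ)) x
    rwa [h0, zero_dotProduct] at this
  have hw : width (poly A b) ≤
      b i - -(∑ k, (c (i.succAbove k) : ℝ) * b (i.succAbove k)) / c i := by
    refine width_le hbdd ⟨x₀, hx₀⟩ hAi (fun x hx => ?_) fun x hx => hx i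
    rw [div_le_iff₀ (by exact_mod_cast hci)]
    have h := hrelR x
    rw [Fin.sum_univ_succAbove _ i] at h
    have hle : ∑ k, (c (i.succAbove k) : ℝ) * (A.map (Int.cast : ℤ → ℝ) *ᵥ x) (i.succAbove k) ≤
        ∑ k, (c (i.succAbove k) : ℝ) * b (i.succAbove k) :=
      Finset.sum_le_sum fun k _ => mul_le_mul_of_nonneg_left (hx _) (hcR _)
    have hval : (A.map (Int.cast : ℤ → ℝ) *ᵥ x) i = ∑ k, (A i k : ℝ) * x k := rfl
    rw [hval] at h
    linarith
  have hS : c i * (c i - 1) ≤ c i * b i + ∑ k, c (i.succAbove k) * b (i.succAbove k) := by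
    have hle : (c i : ℝ) ≤ maxDet A := by
      have := natAbs_det_succAbove_le_maxDet A i
      have h' : c i ≤ maxDet A := by
        rw [hc]
        simp only [Int.abs_eq_natAbs]
        exact_mod_cast this
      exact_mod_cast h'
    have hciR : (0 : ℝ) < c i := by exact_mod_cast hci
    have h := mul_le_mul_of_nonneg_left ((sub_le_sub_right hle 1).trans (hwidth.trans hw)) hciR.le
    rw [mul_sub (c i : ℝ) (b i : ℝ), mul_div_cancel₀ _ hciR.ne', sub_neg_eq_add] at h
    exact_mod_cast h
  obtain ⟨z, y, hy, hysum, hzy⟩ := exists_nonneg_sum_lt_natAbs_det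
    (A.submatrix i.succAbove id) (hminor i) (fun k => b (i.succAbove k))
  have hrow : ∀ k, (A *ᵥ z) (i.succAbove k) = b (i.succAbove k) - y k := fun k =>
    eq_sub_of_add_eq (congrFun hzy k)
  have hint : ∀ j, (A *ᵥ z) j ≤ b j := by
    intro j
    rcases eq_or_ne j i with rfl | hj
    · have h := dotProduct_mulVec c A z
      rw [hvec, zero_dotProduct, dotProduct, Fin.sum_univ_succAbove _ j] at h
      simp only [hrow, mul_sub, Finset.sum_sub_distrib] at h
      have hcy : ∑ k, c (j.succAbove k) * y k ≤ c j * (c j - 1) :=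
        calc ∑ k, c (j.succAbove k) * y k ≤ ∑ k, c j * y k :=
              Finset.sum_le_sum fun k _ => mul_le_mul_of_nonneg_right (hmax _) (hy k)
          _ = c j * ∑ k, y k := (Finset.mul_sum ..).symm
          _ ≤ c j * (c j - 1) := mul_le_mul_of_nonneg_left (Int.le_sub_one_of_lt hysum) hci.le
      refine le_of_mul_le_mul_left ?_ hci
      linarith
    · obtain ⟨k, rfl⟩ := Fin.exists_succAbove_eq hj
      rw [hrow]
      linarith [hy k]
  refine ⟨z, fun j => ?_⟩
  have hcast : (A.map (Int.cast : ℤ → ℝ) *ᵥ fun k => (z k : ℝ)) j = ((A *ᵥ z) j : ℤ) := by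
    simp [Matrix.mulVec, dotProduct]
  rw [hcast]
  exact_mod_cast hint j
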